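/- Let X be a separable Banach space and μ a centered Gaussian Borel probability measure on X. Let K ⊆ X be a Borel set which is convex and symmetric (K = −K) with μ(K) > 0. Then lim_{n→∞} μ(nK) = 1, where nK = {n x : x ∈ K}. -/

import Mathlib

open MeasureTheory Filter Topology ProbabilityTheory Pointwise

/-- The linear subspace `⋃ n, n • K` swept out by the dilates
of a balanced convex nonempty set. -/
def Convex.iUnionSMul {E : Type*} [AddCommGroup E] [Module ℝ E] {K : Set E}
    (hconv : Convex ℝ K) (hbal : Balanced ℝ K) (hne : K.Nonempty) : Submodule ℝ E where
  carrier := ⋃ n : ℕ, (n : ℝ) • K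
  zero_mem' := by
    obtain ⟨x, hx⟩ := hne
    exact Set.mem_iUnion.2 ⟨0, x, hx, by simp⟩
  add_mem' := by
    intro x y hx hy
    obtain ⟨n, hn⟩ := Set.mem_iUnion.1 hx
    obtain ⟨m, hm⟩ := Set.mem_iUnion.1 hy
    refine Set.mem_iUnion.2 ⟨n + m, ?_⟩
    rw [Nat.cast_add, hconv.add_smul n.cast_nonneg m.cast_nonneg]
    exact Set.add_mem_add hn hm
  smul_mem' := by
    intro c x hx
    obtain ⟨n, hn⟩ := Set.mem_iUnion.1 hx
    obtain ⟨m, hm⟩ := exists_nat_ge ‖c * n‖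
    refine Set.mem_iUnion.2 ⟨m, hbal.smul_mono (hm.trans (le_abs_self _)) ?_⟩
    rw [mul_smul]
    exact Set.smul_mem_smul_set hn

theorem Convex.balanced_of_eq_neg {E : Type*} [AddCommGroup E] [Module ℝ E] {K : Set E}
    (hconv : Convex ℝ K) (hsymm : K = -K) : Balanced ℝ K := by
  rintro c hc _ ⟨x, hx, rfl⟩
  obtain ⟨h₁, h₂⟩ := abs_le.1 (Real.norm_eq_abs c ▸ hc)
  have hnx : -x ∈ K := by
    rw [hsymm]
    exact Set.neg_mem_neg.2 hx
  have h := hconv hx hnx (a := (1 + c) / 2) (b := (1 - c) / 2) (by linarith) (by linarith) (by ring)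
  convert h using 1
  module

/-- **Zero-one law** for measurable subspaces, under a measure whose square is invariant under
rotations. -/
theorem MeasureTheory.measure_submodule_eq_zero_or_compl_of_map_rotation_eq_self
    {E : Type*} [NormedAddCommGroup E] [NormedSpace ℝ E] [SecondCountableTopology E]
    [MeasurableSpace E] [BorelSpace E] {μ : Measure E} [IsFiniteMeasure μ]
    (hμ : ∀ θ : ℝ, (μ.prod μ).map (ContinuousLinearMap.rotation θ) = μ.prod μ)
    (V : Submodule ℝ E) (hV : MeasurableSet (V : Set E)) :
    μ V = 0 ∨ μ (V : Set E)ᶜ = 0 := by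
  rw [← mul_eq_zero, ← Measure.prod_prod]
  by_contra hne
  set B : Set (E × E) := (V : Set E) ×ˢ (V : Set E)ᶜ
  have hB : MeasurableSet B := hV.prod hV.compl
  let A : Set.Ioo (0 : ℝ) 1 → Set (E × E) := fun θ ↦ ContinuousLinearMap.rotation θ.1 ⁻¹' B
  have hrot (θ : ℝ) : Measurable (ContinuousLinearMap.rotation θ : E × E →L[ℝ] E × E) :=
    (ContinuousLinearMap.continuous _).measurable
  have hA (θ) : MeasurableSet (A θ) := hrot _ hB
  have hAμ (θ) : μ.prod μ (A θ) = μ.prod μ B := by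
    rw [← Measure.map_apply (hrot _) hB, hμ]
  have hdisj : Pairwise (Function.onFun Disjoint A) := by
    intro θ φ hθφ
    refine Set.disjoint_left.2 fun x hθ hφ ↦ hθ.2 ?_
    have hsin : Real.sin (φ - θ) ≠ 0 := by
      intro h0
      have hθ' := θ.2
      have hφ' := φ.2
      have hpi := Real.pi_gt_three
      rw [Real.sin_eq_zero_iff_of_lt_of_lt (by linarith [hθ'.2, hφ'.1])
        (by linarith [hθ'.1, hφ'.2])] at h0
      exact hθφ (Subtype.ext (sub_eq_zero.1 h0).symm)
    refine (V.smul_mem_iff hsin).1 ?_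
    have h := V.sub_mem hφ.1 (V.smul_mem (Real.cos (φ - θ)) hθ.1)
    convert h using 1
    simp only [ContinuousLinearMap.rotation_apply, Real.sin_sub, Real.cos_sub]
    have hcs := Real.cos_sq_add_sin_sq (θ : ℝ)
    match_scalars
    · linear_combination Real.cos φ * hcs
    · linear_combination Real.sin φ * hcs
  have hfin := Measure.finite_const_le_meas_of_disjoint_iUnion (μ.prod μ) (pos_iff_ne_zero.2 hne)
    hA hdisj (measure_ne_top _ _)
  simp only [hAμ, le_refl, Set.ofPred_true] at hfin
  exact (Set.Ioo_infinite (zero_lt_one' ℝ)).to_subtype.not_finite (Set.finite_univ_iff.1 hfin)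

/-- Let `μ` be a centered Gaussian Borel probability measure on a separable
Banach space `X` (i.e. the pushforward of `μ` under every continuous linear
functional is a centered Gaussian measure on `ℝ`). If `K ⊆ X` is a Borel,
convex and symmetric set with `μ(K) > 0`, then `μ(nK) → 1` as `n → ∞`. -/
theorem statement6
    {X : Type*} [NormedAddCommGroup X] [NormedSpace ℝ X] [CompleteSpace X]
    [TopologicalSpace.SeparableSpace X] [MeasurableSpace X] [BorelSpace X]
    (μ : Measure X) [IsProbabilityMeasure μ]
    (hgauss : ∀ f : X →L[ℝ] ℝ, ∃ v : NNReal, μ.map f = gaussianReal 0 v)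
    (K : Set X) (hK : MeasurableSet K) (hconv : Convex ℝ K) (hsymm : K = -K)
    (hpos : 0 < μ K) :
    Tendsto (fun n : ℕ => μ ((n : ℝ) • K)) atTop (𝓝 1) := by
  have : SecondCountableTopology X := UniformSpace.secondCountable_of_separable X
  have : IsGaussian μ := isGaussian_of_map_eq_gaussianReal fun L ↦ ⟨0, hgauss L⟩
  have hmean (L : StrongDual ℝ X) : μ[L] = 0 := by
    obtain ⟨v, hv⟩ := hgauss L
    have h := integral_id_gaussianReal (μ := 0) (v := v)
    rwa [← hv, integral_map (by fun_prop) (by fun_prop)] at h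
  have hbal := hconv.balanced_of_eq_neg hsymm
  have hmono : Monotone fun n : ℕ ↦ (n : ℝ) • K := fun n m hnm ↦
    hbal.smul_mono (by simpa using hnm)
  set V := hconv.iUnionSMul hbal (nonempty_of_measure_ne_zero hpos.ne')
  have hVdef : (V : Set X) = ⋃ n : ℕ, (n : ℝ) • K := rfl
  have hV : MeasurableSet (V : Set X) := MeasurableSet.iUnion fun n ↦ hK.const_smul₀ _
  have hKV : K ⊆ V := fun x hx ↦ Set.mem_iUnion.2 ⟨1, x, hx, by simp⟩
  have hcompl := (measure_submodule_eq_zero_or_compl_of_map_rotation_eq_self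
    (IsGaussian.map_rotation_eq_self_of_forall_strongDual_eq_zero hmean) V hV).resolve_left
    (hpos.trans_le (measure_mono hKV)).ne'
  rw [← (prob_compl_eq_zero_iff hV).1 hcompl, hVdef]
  exact tendsto_measure_iUnion_atTop hmono
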